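/- (Theorem 1.) Let E be a real normed vector space equipped with its Borel σ-algebra, let g : E ≃L[ℝ] E be a continuous linear equivalence, and let v, w : ℝ → E → E be time-dependent vector fields with w t (g x) = g (v t x) for all t, x, where w is continuous and Lipschitz in the space variable with a uniform Lipschitz constant on [0,1]. Let φ, ψ : E → ℝ → E be solution maps: for every x₀ ∈ E, the curve φ x₀ solves the v-ODE on [0,1] with φ x₀ 0 = x₀, and ψ x₀ solves the w-ODE on [0,1] with ψ x₀ 0 = x₀; assume moreover that for each t ∈ [0,1] the maps x₀ ↦ φ x₀ t and x₀ ↦ ψ x₀ t are measurable. Let μ₀ be a measure on E that is isotropic with respect to g, i.e. map g μ₀ = μ₀. Then for every t ∈ [0,1], map (fun x₀ => ψ x₀ t) μ₀ = map g (map (fun x₀ => φ x₀ t) μ₀). -/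

import Mathlib

open Set MeasureTheory NNReal

/-- **Theorem 1 (equivariance of flow-matching policies).**
If the velocity fields satisfy the equivariance relation `w t (g x) = g (v t x)`,
`w` is continuous and uniformly Lipschitz in space on `[0,1]`, `φ` and `ψ` are
(measurable-in-the-initial-condition) solution maps of the `v`- and `w`-ODEs on
`[0,1]`, and the prior `μ₀` is isotropic (`map g μ₀ = μ₀`), then for every
`t ∈ [0,1]` the time-`t` output distributions satisfy
`map (fun x₀ => ψ x₀ t) μ₀ = map g (map (fun x₀ => φ x₀ t) μ₀)`. -/
theorem flow_matching_equivariant_distribution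
    {E : Type*} [NormedAddCommGroup E] [NormedSpace ℝ E]
    [MeasurableSpace E] [BorelSpace E]
    (g : E ≃L[ℝ] E) (v w : ℝ → E → E)
    (hequiv : ∀ t x, w t (g x) = g (v t x))
    (hw_cont : Continuous fun p : ℝ × E => w p.1 p.2)
    (K : ℝ≥0) (hw_lip : ∀ t ∈ Icc (0 : ℝ) 1, LipschitzWith K (w t))
    (φ ψ : E → ℝ → E)
    (hφ : ∀ x₀, ∀ t ∈ Icc (0 : ℝ) 1, HasDerivAt (φ x₀) (v t (φ x₀ t)) t)
    (hφ0 : ∀ x₀, φ x₀ 0 = x₀)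
    (hψ : ∀ x₀, ∀ t ∈ Icc (0 : ℝ) 1, HasDerivAt (ψ x₀) (w t (ψ x₀ t)) t)
    (hψ0 : ∀ x₀, ψ x₀ 0 = x₀)
    (hφ_meas : ∀ t ∈ Icc (0 : ℝ) 1, Measurable fun x₀ => φ x₀ t)
    (hψ_meas : ∀ t ∈ Icc (0 : ℝ) 1, Measurable fun x₀ => ψ x₀ t)
    (μ₀ : Measure E) (hiso : Measure.map g μ₀ = μ₀) :
    ∀ t ∈ Icc (0 : ℝ) 1,
      Measure.map (fun x₀ => ψ x₀ t) μ₀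
        = Measure.map g (Measure.map (fun x₀ => φ x₀ t) μ₀) := by
  intro t ht
  have hg : Measurable g := g.continuous.measurable
  have key : ∀ x, ψ (g x) t = g (φ x t) := fun x => by
    have hgφ : ∀ s ∈ Icc (0 : ℝ) 1,
        HasDerivAt (fun s => g (φ x s)) (w s (g (φ x s))) s := fun s hs => by
      rw [hequiv]
      exact g.hasFDerivAt.comp_hasDerivAt s (hφ x s hs)
    exact ODE_solution_unique_of_mem_Icc_right (v := w) (s := fun _ => univ)
      (fun s hs => (hw_lip s (Ico_subset_Icc_self hs)).lipschitzOnWith)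
      (HasDerivAt.continuousOn (hψ (g x)))
      (fun s hs => (hψ (g x) s (Ico_subset_Icc_self hs)).hasDerivWithinAt)
      (fun _ _ => mem_univ _)
      (HasDerivAt.continuousOn hgφ)
      (fun s hs => (hgφ s (Ico_subset_Icc_self hs)).hasDerivWithinAt)
      (fun _ _ => mem_univ _)
      (by simp only [hψ0, hφ0]) ht
  calc Measure.map (fun x₀ => ψ x₀ t) μ₀
      = Measure.map (fun x₀ => ψ x₀ t) (Measure.map g μ₀) := by rw [hiso]
    _ = Measure.map (fun x => g (φ x t)) μ₀ := by
      rw [Measure.map_map (hψ_meas t ht) hg]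
      exact congrArg (Measure.map · μ₀) (funext key)
    _ = Measure.map g (Measure.map (fun x₀ => φ x₀ t) μ₀) :=
      (Measure.map_map hg (hφ_meas t ht)).symm
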